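/- Let t² ∈ ℝ with t² ≠ 0, and consider on the half-plane U = {(x¹,x²) ∈ ℝ² : x¹ > 0} the connection with Christoffel symbols Γ_{11}¹ = 1, Γ_{12}² = 1 + t²/x¹, Γ_{21}² = 1 − t²/x¹, and all other Γ_{ij}^k = 0 (the flat Type A surface M₁⁶ perturbed by the Type B torsion T¹ = 0, T² = t²/x¹). Then a smooth vector field X on U is an affine Killing vector field for this connection if and only if X lies in the ℝ-linear span of the three vector fields (0,1), (0, x²), and (0, e^{−x¹}). -/

import Mathlib

open Real

/-- The partial derivative `∂f/∂x^i` of a function on `ℝ²` (points are `Fin 2 → ℝ`). -/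
noncomputable def pd (f : (Fin 2 → ℝ) → ℝ) (i : Fin 2) (p : Fin 2 → ℝ) : ℝ :=
  fderiv ℝ f p (Pi.single i 1)

/-- The affine Killing operator
`K^Γ_{ij}^k(v) = ∂_i∂_j v^k + v^l ∂_l Γ_{ij}^k − Γ_{ij}^l ∂_l v^k + Γ_{il}^k ∂_j v^l + Γ_{lj}^k ∂_i v^l`
(summation over `l`). -/
noncomputable def killingOp (Γ : Fin 2 → Fin 2 → Fin 2 → (Fin 2 → ℝ) → ℝ)
    (v : Fin 2 → (Fin 2 → ℝ) → ℝ) (i j k : Fin 2) (p : Fin 2 → ℝ) : ℝ :=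
  pd (fun q => pd (v k) j q) i p
    + (∑ l : Fin 2, v l p * pd (Γ i j k) l p)
    - (∑ l : Fin 2, Γ i j l p * pd (v k) l p)
    + (∑ l : Fin 2, Γ i l k p * pd (v l) j p)
    + (∑ l : Fin 2, Γ l j k p * pd (v l) i p)

/-- `v` is an affine Killing vector field for the connection `Γ` on `U`:
all eight affine Killing equations hold on `U`. -/
def IsAffineKilling (U : Set (Fin 2 → ℝ))
    (Γ : Fin 2 → Fin 2 → Fin 2 → (Fin 2 → ℝ) → ℝ)
    (v : Fin 2 → (Fin 2 → ℝ) → ℝ) : Prop :=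
  ∀ i j k : Fin 2, ∀ p ∈ U, killingOp Γ v i j k p = 0

/-- The right half-plane is open. -/
theorem isOpen_halfPlane : IsOpen {p : Fin 2 → ℝ | 0 < p 0} :=
  isOpen_lt continuous_const (continuous_apply 0)

/-- The right half-plane is convex. -/
theorem convex_halfPlane : Convex ℝ {p : Fin 2 → ℝ | 0 < p 0} :=
  convex_halfSpace_gt (f := fun p : Fin 2 → ℝ => p 0) ⟨fun _ _ => rfl, fun _ _ => rfl⟩ 0

theorem pd_congr {U : Set (Fin 2 → ℝ)} (hU : IsOpen U) {f g : (Fin 2 → ℝ) → ℝ}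
    (h : ∀ q ∈ U, f q = g q) (i : Fin 2) {p : Fin 2 → ℝ} (hp : p ∈ U) :
    pd f i p = pd g i p := by
  have h' : f =ᶠ[nhds p] g := Filter.eventually_of_mem (hU.mem_nhds hp) h
  rw [pd, pd, h'.fderiv_eq]

theorem pd_const (c : ℝ) (i : Fin 2) (p : Fin 2 → ℝ) : pd (fun _ => c) i p = 0 := by
  simp [pd]

theorem pd_mul {f g : (Fin 2 → ℝ) → ℝ} {p : Fin 2 → ℝ} (hf : DifferentiableAt ℝ f p)
    (hg : DifferentiableAt ℝ g p) (i : Fin 2) :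
    pd (fun q => f q * g q) i p = f p * pd g i p + g p * pd f i p := by
  simp [pd, fderiv_fun_mul hf hg]

theorem pd_add {f g : (Fin 2 → ℝ) → ℝ} {p : Fin 2 → ℝ} (hf : DifferentiableAt ℝ f p)
    (hg : DifferentiableAt ℝ g p) (i : Fin 2) :
    pd (fun q => f q + g q) i p = pd f i p + pd g i p := by
  simp [pd, fderiv_fun_add hf hg]

theorem pd_sub {f g : (Fin 2 → ℝ) → ℝ} {p : Fin 2 → ℝ} (hf : DifferentiableAt ℝ f p)
    (hg : DifferentiableAt ℝ g p) (i : Fin 2) :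
    pd (fun q => f q - g q) i p = pd f i p - pd g i p := by
  simp [pd, fderiv_fun_sub hf hg]

/-- Partial derivatives of a function of a single coordinate. -/
theorem pd_comp_apply {f : ℝ → ℝ} {f' : ℝ} {p : Fin 2 → ℝ} {j : Fin 2}
    (hf : HasDerivAt f f' (p j)) (i : Fin 2) :
    pd (fun q => f (q j)) i p = f' * (Pi.single i 1 : Fin 2 → ℝ) j := by
  have h := hf.comp_hasFDerivAt p (hasFDerivAt_apply (𝕜 := ℝ) j p)
  change fderiv ℝ (f ∘ fun q : Fin 2 → ℝ => q j) p _ = _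
  rw [h.fderiv]
  simp

theorem pd_const_add_div (a s : ℝ) {p : Fin 2 → ℝ} (hp : p 0 ≠ 0) (i : Fin 2) :
    pd (fun q => a + s / q 0) i p = -(s / p 0 ^ 2) * (Pi.single i 1 : Fin 2 → ℝ) 0 := by
  have h : HasDerivAt (fun x : ℝ => a + s / x) (-(s / p 0 ^ 2)) (p 0) := by
    have := ((hasDerivAt_inv hp).const_mul s).const_add a
    simpa [div_eq_mul_inv] using this
  exact pd_comp_apply h i

theorem pd_const_sub_div (a s : ℝ) {p : Fin 2 → ℝ} (hp : p 0 ≠ 0) (i : Fin 2) :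
    pd (fun q => a - s / q 0) i p = s / p 0 ^ 2 * (Pi.single i 1 : Fin 2 → ℝ) 0 := by
  have h := pd_const_add_div a (-s) hp i
  simpa [neg_div, ← sub_eq_add_neg] using h

/-- Partial derivatives of `a + b x² + c e^{-x¹}`. -/
theorem pd_affine_add_exp (a b c : ℝ) (i : Fin 2) (p : Fin 2 → ℝ) :
    pd (fun q => a + b * q 1 + c * Real.exp (-q 0)) i p
      = b * (Pi.single i 1 : Fin 2 → ℝ) 1
        + -(c * Real.exp (-p 0)) * (Pi.single i 1 : Fin 2 → ℝ) 0 := by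
  have h1 : HasDerivAt (fun x : ℝ => a + b * x) b (p 1) := by
    simpa using ((hasDerivAt_id (p 1)).const_mul b).const_add a
  have h0 : HasDerivAt (fun x : ℝ => c * Real.exp (-x)) (-(c * Real.exp (-p 0))) (p 0) := by
    simpa using ((hasDerivAt_id (p 0)).neg.exp).const_mul c
  rw [pd_add (by fun_prop) (by fun_prop), pd_comp_apply h1, pd_comp_apply h0]

theorem differentiableAt_of_contDiffOn {U : Set (Fin 2 → ℝ)} (hU : IsOpen U)
    {f : (Fin 2 → ℝ) → ℝ} (hf : ContDiffOn ℝ (⊤ : ℕ∞) f U) {p : Fin 2 → ℝ} (hp : p ∈ U) :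
    DifferentiableAt ℝ f p :=
  (hf.contDiffAt (hU.mem_nhds hp)).differentiableAt (by simp)

theorem contDiffOn_pd {U : Set (Fin 2 → ℝ)} (hU : IsOpen U) {f : (Fin 2 → ℝ) → ℝ}
    (hf : ContDiffOn ℝ (⊤ : ℕ∞) f U) (i : Fin 2) : ContDiffOn ℝ (⊤ : ℕ∞) (pd f i) U :=
  (hf.fderiv_of_isOpen hU (m := (⊤ : ℕ∞)) (by simp)).clm_apply contDiffOn_const

/-- Partial derivatives of smooth functions commute. -/
theorem pd_comm {U : Set (Fin 2 → ℝ)} (hU : IsOpen U) {f : (Fin 2 → ℝ) → ℝ}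
    (hf : ContDiffOn ℝ (⊤ : ℕ∞) f U) (i j : Fin 2) {p : Fin 2 → ℝ} (hp : p ∈ U) :
    pd (pd f i) j p = pd (pd f j) i p := by
  have hd : DifferentiableAt ℝ (fderiv ℝ f) p :=
    ((hf.fderiv_of_isOpen hU (m := (⊤ : ℕ∞)) (by simp)).contDiffAt
      (hU.mem_nhds hp)).differentiableAt (by simp)
  have key : ∀ k l : Fin 2, pd (pd f k) l p
      = fderiv ℝ (fderiv ℝ f) p (Pi.single l 1) (Pi.single k 1) := by
    intro k l
    change fderiv ℝ (fun q => fderiv ℝ f q (Pi.single k 1)) p _ = _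
    rw [fderiv_clm_apply hd (differentiableAt_const _)]
    simp
  have hs : IsSymmSndFDerivAt ℝ f p :=
    (hf.contDiffAt (hU.mem_nhds hp)).isSymmSndFDerivAt (by
      simpa using WithTop.coe_le_coe.mpr (le_top (a := (2 : ℕ∞))))
  rw [key, key, hs.eq]

/-- A function with vanishing partial derivatives on a convex open set is constant there. -/
theorem exists_const_of_pd_eq_zero {U : Set (Fin 2 → ℝ)} (hU : IsOpen U) (hc : Convex ℝ U)
    {f : (Fin 2 → ℝ) → ℝ} (hf : ∀ p ∈ U, DifferentiableAt ℝ f p)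
    (h0 : ∀ p ∈ U, pd f 0 p = 0) (h1 : ∀ p ∈ U, pd f 1 p = 0) :
    ∃ c, ∀ p ∈ U, f p = c := by
  refine hU.exists_is_const_of_fderiv_eq_zero hc.isPreconnected
    (fun p hp => (hf p hp).differentiableWithinAt) fun p hp => ?_
  ext x
  have hx : x = x 0 • (Pi.single 0 1 : Fin 2 → ℝ) + x 1 • (Pi.single 1 1 : Fin 2 → ℝ) := by
    ext k
    fin_cases k <;> simp
  have e0 := h0 p hp
  have e1 := h1 p hp
  simp only [pd] at e0 e1
  rw [hx, map_add, map_smul, map_smul, e0, e1]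
  simp

/-- A function on the half-plane which satisfies `∂₁u = u / x¹` and `∂₁∂₁u + ∂₁u = 0`
vanishes. -/
theorem eq_zero_of_pd_eq_div {u : (Fin 2 → ℝ) → ℝ}
    (hu : ContDiffOn ℝ (⊤ : ℕ∞) u {p : Fin 2 → ℝ | 0 < p 0})
    (h : ∀ p ∈ {p : Fin 2 → ℝ | 0 < p 0}, p 0 * pd u 0 p = u p)
    (h' : ∀ p ∈ {p : Fin 2 → ℝ | 0 < p 0}, pd (pd u 0) 0 p + pd u 0 p = 0)
    {p : Fin 2 → ℝ} (hp : p ∈ {p : Fin 2 → ℝ | 0 < p 0}) : u p = 0 := by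
  have e := pd_congr isOpen_halfPlane h 0 hp
  rw [pd_mul (differentiableAt_apply 0 p) (differentiableAt_of_contDiffOn isOpen_halfPlane
    (contDiffOn_pd isOpen_halfPlane hu 0) hp), pd_comp_apply (hasDerivAt_id' (p 0))] at e
  have hp' : 0 < p 0 := hp
  have e2 : p 0 * pd (pd u 0) 0 p = 0 := by
    simp only [Pi.single_eq_same] at e
    linarith
  have e3 : pd (pd u 0) 0 p = 0 := (mul_eq_zero.mp e2).resolve_left hp'.ne'
  rw [← h p hp]
  have := h' p hp
  rw [e3, zero_add] at this
  rw [this, mul_zero]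

/-- Solutions of `∂₁∂₁w + ∂₁w = ∂₁∂₂w = ∂₂∂₂w = 0` on the half-plane. -/
theorem eq_affine_add_exp {w : (Fin 2 → ℝ) → ℝ}
    (hw : ContDiffOn ℝ (⊤ : ℕ∞) w {p : Fin 2 → ℝ | 0 < p 0})
    (h00 : ∀ p ∈ {p : Fin 2 → ℝ | 0 < p 0}, pd (pd w 0) 0 p + pd w 0 p = 0)
    (h01 : ∀ p ∈ {p : Fin 2 → ℝ | 0 < p 0}, pd (pd w 1) 0 p = 0)
    (h11 : ∀ p ∈ {p : Fin 2 → ℝ | 0 < p 0}, pd (pd w 1) 1 p = 0) :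
    ∃ a b c : ℝ, ∀ p ∈ {p : Fin 2 → ℝ | 0 < p 0},
      w p = a + b * p 1 + c * Real.exp (-p 0) := by
  have hU := isOpen_halfPlane
  have hd : ∀ i, ∀ p ∈ {p : Fin 2 → ℝ | 0 < p 0}, DifferentiableAt ℝ (pd w i) p :=
    fun i p hp => differentiableAt_of_contDiffOn hU (contDiffOn_pd hU hw i) hp
  obtain ⟨b, hb⟩ := exists_const_of_pd_eq_zero hU convex_halfPlane (hd 1) h01 h11
  obtain ⟨d, hc⟩ : ∃ d, ∀ p ∈ {p : Fin 2 → ℝ | 0 < p 0}, pd w 0 p * Real.exp (p 0) = d := by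
    have hpd : ∀ i, ∀ p ∈ {p : Fin 2 → ℝ | 0 < p 0},
        pd (fun q => pd w 0 q * Real.exp (q 0)) i p
          = pd w 0 p * (Real.exp (p 0) * (Pi.single i 1 : Fin 2 → ℝ) 0)
            + Real.exp (p 0) * pd (pd w 0) i p := by
      intro i p hp
      rw [pd_mul (hd 0 p hp) (by fun_prop), pd_comp_apply (Real.hasDerivAt_exp (p 0))]
    refine exists_const_of_pd_eq_zero hU convex_halfPlane
      (fun p hp => (hd 0 p hp).mul (by fun_prop)) (fun p hp => ?_) fun p hp => ?_
    · rw [hpd 0 p hp, Pi.single_eq_same]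
      linear_combination Real.exp (p 0) * h00 p hp
    · rw [hpd 1 p hp, pd_comm hU hw 0 1 hp, h01 p hp]
      simp
  have hx : ∀ p ∈ {p : Fin 2 → ℝ | 0 < p 0}, pd w 0 p = d * Real.exp (-p 0) := by
    intro p hp
    rw [← hc p hp, mul_assoc, ← Real.exp_add]
    simp
  have hdw : ∀ p ∈ {p : Fin 2 → ℝ | 0 < p 0}, DifferentiableAt ℝ w p :=
    fun p hp => differentiableAt_of_contDiffOn hU hw hp
  have hdm : ∀ p : Fin 2 → ℝ,
      DifferentiableAt ℝ (fun q : Fin 2 → ℝ => 0 + b * q 1 + -d * Real.exp (-q 0)) p := by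
    intro p
    fun_prop
  obtain ⟨a, ha⟩ := exists_const_of_pd_eq_zero hU convex_halfPlane
    (f := fun q => w q - (0 + b * q 1 + -d * Real.exp (-q 0)))
    (fun p hp => (hdw p hp).sub (hdm p))
    (fun p hp => by
      rw [pd_sub (hdw p hp) (hdm p), pd_affine_add_exp, hx p hp]
      simp)
    (fun p hp => by
      rw [pd_sub (hdw p hp) (hdm p), pd_affine_add_exp, hb p hp]
      simp)
  refine ⟨a, b, -d, fun p hp => ?_⟩
  linear_combination ha p hp

theorem stmt13 (t2 : ℝ) (ht : t2 ≠ 0)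
    (v : Fin 2 → (Fin 2 → ℝ) → ℝ)
    (hv : ∀ i : Fin 2, ContDiffOn ℝ (⊤ : ℕ∞) (v i) {p : Fin 2 → ℝ | 0 < p 0}) :
    IsAffineKilling {p : Fin 2 → ℝ | 0 < p 0}
      (fun i j k => fun p : Fin 2 → ℝ =>
        ![![![(1 : ℝ), 0], ![0, 1 + t2 / p 0]], ![![0, 1 - t2 / p 0], ![0, 0]]] i j k) v
    ↔ ∃ a b c : ℝ, ∀ p ∈ {p : Fin 2 → ℝ | 0 < p 0},
        v 0 p = 0
        ∧ v 1 p = a + b * p 1 + c * Real.exp (-p 0) := by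
  have hU := isOpen_halfPlane
  constructor
  · intro h
    have hu_y : ∀ p ∈ {p : Fin 2 → ℝ | 0 < p 0}, pd (v 0) 1 p = 0 := by
      intro p hp
      have hp' : p 0 ≠ 0 := (show 0 < p 0 from hp).ne'
      have e1 := h 0 1 0 p hp
      have e2 := h 1 0 0 p hp
      have e3 := pd_comm hU (hv 0) 0 1 hp
      simp [killingOp, Fin.sum_univ_two, pd_const] at e1 e2
      have e4 : t2 / p 0 * pd (v 0) 1 p = 0 := by linear_combination (e2 - e1 - e3) / 2
      exact (mul_eq_zero.mp e4).resolve_left (div_ne_zero ht hp')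
    have hu : ∀ p ∈ {p : Fin 2 → ℝ | 0 < p 0}, v 0 p = 0 := by
      refine fun p hp => eq_zero_of_pd_eq_div (hv 0) (fun p hp => ?_) (fun p hp => ?_) hp
      · have hp' : p 0 ≠ 0 := (show 0 < p 0 from hp).ne'
        have e1 := h 0 1 1 p hp
        have e2 := h 1 0 1 p hp
        have e3 := pd_comm hU (hv 1) 0 1 hp
        simp [killingOp, Fin.sum_univ_two, pd_const_add_div _ _ hp',
          pd_const_sub_div _ _ hp'] at e1 e2
        have e4 : t2 / p 0 ^ 2 * (p 0 * pd (v 0) 0 p - v 0 p) = 0 := by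
          have e5 : t2 / p 0 ^ 2 * p 0 = t2 / p 0 := by field_simp
          linear_combination (e1 - e2 + e3) / 2 + pd (v 0) 0 p * e5
        exact sub_eq_zero.mp
          ((mul_eq_zero.mp e4).resolve_left (div_ne_zero ht (pow_ne_zero 2 hp')))
      · have e := h 0 0 0 p hp
        simpa [killingOp, Fin.sum_univ_two, pd_const] using e
    have hu_x : ∀ p ∈ {p : Fin 2 → ℝ | 0 < p 0}, pd (v 0) 0 p = 0 := fun p hp =>
      (pd_congr hU hu 0 hp).trans (pd_const 0 0 p)
    suffices hw : ∃ a b c : ℝ, ∀ p ∈ {p : Fin 2 → ℝ | 0 < p 0},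
        v 1 p = a + b * p 1 + c * Real.exp (-p 0) by
      obtain ⟨a, b, c, hw⟩ := hw
      exact ⟨a, b, c, fun p hp => ⟨hu p hp, hw p hp⟩⟩
    refine eq_affine_add_exp (hv 1) (fun p hp => ?_) (fun p hp => ?_) (fun p hp => ?_)
    · have e := h 0 0 1 p hp
      simp [killingOp, Fin.sum_univ_two, pd_const] at e
      linear_combination e
    · have e := h 0 1 1 p hp
      simpa [killingOp, Fin.sum_univ_two, pd_const_add_div _ _ (show 0 < p 0 from hp).ne',
        hu p hp, hu_x p hp] using e
    · have e := h 1 1 1 p hp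
      simpa [killingOp, Fin.sum_univ_two, pd_const, hu_y p hp] using e
  · rintro ⟨a, b, c, h⟩ i j k p hp
    have hp' : p 0 ≠ 0 := (show 0 < p 0 from hp).ne'
    have hu : ∀ i, ∀ p ∈ {p : Fin 2 → ℝ | 0 < p 0}, pd (v 0) i p = 0 := fun i p hp =>
      (pd_congr hU (fun q hq => (h q hq).1) i hp).trans (pd_const 0 i p)
    have hu2 : ∀ i j, pd (pd (v 0) j) i p = 0 := fun i j =>
      (pd_congr hU (hu j) i hp).trans (pd_const 0 i p)
    have hw : ∀ i, ∀ p ∈ {p : Fin 2 → ℝ | 0 < p 0}, pd (v 1) i p = _ := fun i p hp =>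
      (pd_congr hU (fun q hq => (h q hq).2) i hp).trans (pd_affine_add_exp a b c i p)
    have hw0 : ∀ p ∈ {p : Fin 2 → ℝ | 0 < p 0},
        pd (v 1) 0 p = 0 + 0 * p 1 + -c * Real.exp (-p 0) := by
      intro p hp
      simp [hw 0 p hp]
    have hw1 : ∀ p ∈ {p : Fin 2 → ℝ | 0 < p 0}, pd (v 1) 1 p = b := by
      intro p hp
      simp [hw 1 p hp]
    have hw20 : ∀ i, pd (pd (v 1) 0) i p = _ := fun i =>
      (pd_congr hU hw0 i hp).trans (pd_affine_add_exp 0 0 (-c) i p)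
    have hw21 : ∀ i, pd (pd (v 1) 1) i p = 0 := fun i =>
      (pd_congr hU hw1 i hp).trans (pd_const b i p)
    fin_cases i <;> fin_cases j <;> fin_cases k <;>
      simp [killingOp, Fin.sum_univ_two, pd_const, pd_const_add_div _ _ hp',
        pd_const_sub_div _ _ hp', (h p hp).1, hu _ p hp, hu2, hw0 p hp, hw1 p hp, hw20, hw21]
    ring
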